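/- arXiv:1306.4532 — 2 statements merged into one kernel-verified Lean document; each statement's English description precedes it below -/
import Mathlib

section
/- The code-space of the Steane code is exactly the joint +1 eigenspace of the six stabilizer generators: {ψ ∈ H7 : ∀ j ∈ Fin 3, gX j ψ = ψ and gZ j ψ = ψ} = Span_ℂ{u₀, u₁}; in particular this joint eigenspace has complex dimension 2. -/
noncomputable section

abbrev V7 := Fin 7 → ZMod 2
abbrev H7 := V7 → ℂ

/-- The three Steane-code supports. -/
def S : Fin 3 → Finset (Fin 7)
  | 0 => {0, 4, 5, 6}
  | 1 => {1, 3, 5, 6}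
  | 2 => {2, 3, 4, 6}

/-- Pauli X on qubit `i`: `X i (e_v) = e_{v'}` with `v' = v` except `v' i = v i + 1`. -/
def Xop (i : Fin 7) : H7 →ₗ[ℂ] H7 where
  toFun ψ := fun v => ψ (v + Pi.single i 1)
  map_add' _ _ := rfl
  map_smul' _ _ := by funext v; simp

/-- Pauli Z on qubit `i`: `Z i (e_v) = (-1)^(v i) e_v`. -/
def Zop (i : Fin 7) : H7 →ₗ[ℂ] H7 where
  toFun ψ := fun v => (-1 : ℂ) ^ (v i).val * ψ v
  map_add' ψ φ := by funext v; simp [mul_add]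
  map_smul' c ψ := by funext v; simp; ring

/-- Stabilizer generator `gX j = ∏_{i ∈ S j} X i` (the factors commute). -/
def gX (j : Fin 3) : H7 →ₗ[ℂ] H7 :=
  (S j).noncommProd (fun i => Xop i) (fun a _ b _ _ => by
    apply LinearMap.ext; intro ψ; funext v
    exact congrArg ψ (add_right_comm v (Pi.single a 1) (Pi.single b 1)))

/-- Stabilizer generator `gZ j = ∏_{i ∈ S j} Z i` (the factors commute). -/
def gZ (j : Fin 3) : H7 →ₗ[ℂ] H7 :=
  (S j).noncommProd (fun i => Zop i) (fun a _ b _ _ => by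
    apply LinearMap.ext; intro ψ; funext v
    show (-1:ℂ) ^ (v a).val * ((-1:ℂ) ^ (v b).val * ψ v)
       = (-1:ℂ) ^ (v b).val * ((-1:ℂ) ^ (v a).val * ψ v)
    ring)

/-- Indicator vector of `S j`. -/
def r (j : Fin 3) : V7 := fun i => if i ∈ S j then 1 else 0

/-- The 𝔽₂-span of the three rows. -/
def Hcode : Submodule (ZMod 2) V7 := Submodule.span (ZMod 2) {r 0, r 1, r 2}

/-- Standard basis vector `e_v`. -/
def e (v : V7) : H7 := Pi.single v 1

/-- Logical codeword `u₀ = 8^{-1/2} ∑_{v ∈ H} e_v`. -/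
def u0 : H7 := ((Real.sqrt 8 : ℂ))⁻¹ • ∑ᶠ v ∈ (Hcode : Set V7), e v

/-- Logical codeword `u₁ = 8^{-1/2} ∑_{v ∈ H} e_{v + 𝟙}`. -/
def u1 : H7 := ((Real.sqrt 8 : ℂ))⁻¹ • ∑ᶠ v ∈ (Hcode : Set V7), e (v + 1)

/-- The codespace `C = Span_ℂ {u₀, u₁}`. -/
def Cspace : Submodule ℂ H7 := Submodule.span ℂ {u0, u1}


theorem my_gX (j : Fin 3) (ψ : H7) (v : V7) : gX j ψ v = ψ (v + r j) := by
  have h : ∀ w : V7, w = r j → gX j ψ v = ψ (v + w) := by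
    fin_cases j
    · intro w hw
      have hs : w = Pi.single 0 1 + (Pi.single 4 1 + (Pi.single 5 1 + Pi.single 6 1)) := by
        rw [hw]; decide
      rw [hs]
      simp [gX, S, Finset.noncommProd_insert_of_notMem, Xop, add_assoc]
    · intro w hw
      have hs : w = Pi.single 1 1 + (Pi.single 3 1 + (Pi.single 5 1 + Pi.single 6 1)) := by
        rw [hw]; decide
      rw [hs]
      simp [gX, S, Finset.noncommProd_insert_of_notMem, Xop, add_assoc]
    · intro w hw
      have hs : w = Pi.single 2 1 + (Pi.single 3 1 + (Pi.single 4 1 + Pi.single 6 1)) := by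
        rw [hw]; decide
      rw [hs]
      simp [gX, S, Finset.noncommProd_insert_of_notMem, Xop, add_assoc]
  exact h _ rfl

theorem my_gZ (j : Fin 3) (ψ : H7) (v : V7) :
    gZ j ψ v = (-1 : ℂ) ^ (∑ i ∈ S j, (v i).val) * ψ v := by
  fin_cases j <;>
    simp [gZ, S, Finset.noncommProd_insert_of_notMem, Zop, pow_add, mul_assoc]

def cw (a b c : ZMod 2) : V7 := a • r 0 + (b • r 1 + c • r 2)

theorem my_mem (v : V7) : v ∈ Hcode ↔ ∃ a b c : ZMod 2, cw a b c = v := by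
  unfold Hcode cw
  rw [Submodule.mem_span_triple]
  simp only [add_assoc]

theorem my_r (j : Fin 3) : r j ∈ Hcode := by
  fin_cases j <;> exact Submodule.subset_span (by simp)

theorem my_one : (1 : V7) ∉ Hcode := by
  rw [my_mem]; decide

theorem my_even (v : V7) (hv : v ∈ Hcode) (j : Fin 3) : Even (∑ i ∈ S j, (v i).val) := by
  obtain ⟨a, b, c, rfl⟩ := (my_mem v).1 hv
  clear hv
  revert a b c j; decide

theorem my_even' (v : V7) (hv : v + 1 ∈ Hcode) (j : Fin 3) : Even (∑ i ∈ S j, (v i).val) := by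
  obtain ⟨a, b, c, h⟩ := (my_mem _).1 hv
  have : v = cw a b c + 1 := by
    rw [h, add_assoc, CharTwo.add_self_eq_zero, add_zero]
  subst this
  clear h hv
  revert a b c j; decide

set_option maxRecDepth 100000 in
theorem my_odd (v : V7) (h : ∀ j, Even (∑ i ∈ S j, (v i).val)) :
    v ∈ Hcode ∨ v + 1 ∈ Hcode := by
  rw [my_mem, my_mem]
  have key : ∀ x0 x1 x2 x3 x4 x5 x6 : ZMod 2,
      (∀ j, Even (∑ i ∈ S j, ((![x0,x1,x2,x3,x4,x5,x6] : V7) i).val)) →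
      (∃ a b c : ZMod 2, cw a b c = ![x0,x1,x2,x3,x4,x5,x6]) ∨
      (∃ a b c : ZMod 2, cw a b c = ![x0,x1,x2,x3,x4,x5,x6] + 1) := by
    decide +kernel
  have hv : v = ![v 0, v 1, v 2, v 3, v 4, v 5, v 6] := by
    funext i; fin_cases i <;> rfl
  rw [hv] at h ⊢
  exact key _ _ _ _ _ _ _ h

open Classical in
theorem my_u0 (v : V7) : u0 v = ((Real.sqrt 8 : ℂ))⁻¹ * if v ∈ Hcode then 1 else 0 := by
  unfold u0
  rw [finsum_mem_eq_toFinset_sum]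
  simp [e, Finset.sum_apply, Pi.single_apply]

open Classical in
theorem my_u1 (v : V7) : u1 v = ((Real.sqrt 8 : ℂ))⁻¹ * if v + 1 ∈ Hcode then 1 else 0 := by
  unfold u1
  rw [finsum_mem_eq_toFinset_sum]
  have : ∀ x : V7, v = x + 1 ↔ v + 1 = x := fun x => by
    constructor
    · rintro rfl; rw [add_assoc, CharTwo.add_self_eq_zero, add_zero]
    · rintro rfl; rw [add_assoc, CharTwo.add_self_eq_zero, add_zero]
  simp [e, Finset.sum_apply, Pi.single_apply, this]

theorem my_s : ((Real.sqrt 8 : ℂ)) ≠ 0 := by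
  norm_num [Complex.ofReal_eq_zero]

theorem my_inv (ψ : H7) (h : ∀ j v, ψ (v + r j) = ψ v) (w : V7) (hw : w ∈ Hcode) (v : V7) :
    ψ (v + w) = ψ v := by
  have h' : ∀ (j : Fin 3) (a : ZMod 2) (v : V7), ψ (v + a • r j) = ψ v := by
    intro j a v
    have : a = 0 ∨ a = 1 := by revert a; decide
    rcases this with rfl | rfl <;> simp [h]
  obtain ⟨a, b, c, rfl⟩ := (my_mem w).1 hw
  unfold cw
  rw [← add_assoc, ← add_assoc, h', h', h']

def eig : Submodule ℂ H7 where
  carrier := {ψ : H7 | ∀ j : Fin 3, gX j ψ = ψ ∧ gZ j ψ = ψ}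
  add_mem' := by
    intro a b ha hb j
    simp [(ha j).1, (ha j).2, (hb j).1, (hb j).2]
  zero_mem' := by intro j; simp
  smul_mem' := by
    intro c a ha j
    simp [(ha j).1, (ha j).2]

theorem my_u0_mem : u0 ∈ eig := by
  intro j
  refine ⟨?_, ?_⟩
  · funext v
    rw [my_gX, my_u0, my_u0, Submodule.add_mem_iff_left _ (my_r j)]
  · funext v
    rw [my_gZ, my_u0]
    by_cases hv : v ∈ Hcode
    · rw [(my_even v hv j).neg_one_pow, one_mul]
    · simp [hv]

theorem my_u1_mem : u1 ∈ eig := by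
  intro j
  refine ⟨?_, ?_⟩
  · funext v
    rw [my_gX, my_u1, my_u1, add_right_comm, Submodule.add_mem_iff_left _ (my_r j)]
  · funext v
    rw [my_gZ, my_u1]
    by_cases hv : v + 1 ∈ Hcode
    · rw [(my_even' v hv j).neg_one_pow, one_mul]
    · simp [hv]

theorem my_notboth (v : V7) (h : v ∈ Hcode) : v + 1 ∉ Hcode := fun h' =>
  my_one ((Submodule.add_mem_iff_right _ h).1 h')

theorem my_sub (ψ : H7) (h : ψ ∈ eig) : ψ ∈ Cspace := by
  unfold Cspace
  rw [Submodule.mem_span_pair]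
  refine ⟨(Real.sqrt 8 : ℂ) * ψ 0, (Real.sqrt 8 : ℂ) * ψ 1, ?_⟩
  have hs := my_s
  have hX : ∀ j v, ψ (v + r j) = ψ v := fun j v => by
    rw [← my_gX j ψ v, (h j).1]
  funext v
  simp only [Pi.add_apply, Pi.smul_apply, smul_eq_mul, my_u0, my_u1]
  by_cases h0 : v ∈ Hcode
  · have h1 := my_notboth v h0
    have h2 := my_inv ψ hX v h0 0
    rw [zero_add] at h2
    simp only [h0, h1, h2, if_true, if_false]
    field_simp
    ring
  · by_cases h1 : v + 1 ∈ Hcode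
    · have h2 := my_inv ψ hX _ h1 1
      rw [add_comm v 1, ← add_assoc, CharTwo.add_self_eq_zero, zero_add] at h2
      simp only [h0, h1, h2, if_true, if_false]
      field_simp
      ring
    · have h3 : ¬ ∀ j, Even (∑ i ∈ S j, (v i).val) := fun hh => by
        rcases my_odd v hh with h | h
        · exact h0 h
        · exact h1 h
      push Not at h3
      obtain ⟨j, hj⟩ := h3
      have h4 := my_gZ j ψ v
      rw [(h j).2, (Nat.not_even_iff_odd.1 hj).neg_one_pow] at h4
      have h5 : ψ v = 0 := by linear_combination h4 / 2
      simp [h0, h1, h5]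

theorem my_li : LinearIndependent ℂ ![u0, u1] := by
  rw [LinearIndependent.pair_iff]
  intro s t h
  have hs := my_s
  have h0 := congrFun h 0
  have h1 := congrFun h 1
  have e1 : (1 : V7) + 1 = 0 := CharTwo.add_self_eq_zero _
  simp only [Pi.add_apply, Pi.smul_apply, smul_eq_mul, my_u0, my_u1, zero_add, e1, my_one,
    Submodule.zero_mem, if_true, if_false] at h0 h1
  constructor
  · simpa [hs] using h0
  · simpa [hs] using h1

/-- The codespace is exactly the joint +1 eigenspace of the six stabilizer
generators, and it has complex dimension 2. -/
theorem codespace_eq_joint_eigenspace :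
    {ψ : H7 | ∀ j : Fin 3, gX j ψ = ψ ∧ gZ j ψ = ψ} = (Cspace : Set H7) ∧
    Module.finrank ℂ Cspace = 2 := by
  constructor
  · apply Set.Subset.antisymm
    · intro ψ h
      exact my_sub ψ h
    · have : Cspace ≤ eig := by
        unfold Cspace
        rw [Submodule.span_le]
        rintro x (rfl | rfl)
        · exact my_u0_mem
        · exact my_u1_mem
      exact this
  · have h := finrank_span_eq_card my_li
    rw [Matrix.range_cons_cons_empty] at h
    exact h

end
end

section
/- A single bit-flip error has deterministic syndrome given by the support membership: for every ψ in the codespace C, every i ∈ Fin 7 and every j ∈ Fin 3, gZ j (X i ψ) = X i ψ if i ∉ S_j, and gZ j (X i ψ) = −(X i ψ) if i ∈ S_j. -/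
noncomputable section

def par (j : Fin 3) : V7 →ₗ[ZMod 2] ZMod 2 where
  toFun v := ∑ i ∈ S j, v i
  map_add' _ _ := by simp [Finset.sum_add_distrib]
  map_smul' _ _ := by simp [Finset.mul_sum]

lemma sgn_add : ∀ a b : ZMod 2, (-1 : ℂ) ^ (a + b).val = (-1) ^ a.val * (-1) ^ b.val := by
  intro a b
  rw [ZMod.val_add, ← pow_add, neg_one_pow_eq_pow_mod_two (n := a.val + b.val)]

lemma noncommProd_Z (s : Finset (Fin 7)) (hc) (ψ : H7) (v : V7) :
    (s.noncommProd (fun i => Zop i) hc) ψ v = (-1 : ℂ) ^ (∑ i ∈ s, v i).val * ψ v := by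
  induction s using Finset.induction_on with
  | empty => simp
  | insert a s ha ih =>
    rw [Finset.noncommProd_insert_of_notMem _ _ _ _ ha, Finset.sum_insert ha, sgn_add, mul_assoc,
      ← ih]
    rfl

lemma gZ_apply (j : Fin 3) (ψ : H7) (v : V7) :
    gZ j ψ v = (-1 : ℂ) ^ (par j v).val * ψ v := noncommProd_Z _ _ _ _

/-- Vectors supported on even-parity basis states. -/
def evenSub (j : Fin 3) : Submodule ℂ H7 where
  carrier := {ψ | ∀ v, par j v ≠ 0 → ψ v = 0}
  add_mem' ha hb v hv := by simp [ha v hv, hb v hv]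
  zero_mem' _ _ := rfl
  smul_mem' c _ ha v hv := by simp [ha v hv]

lemma Hcode_par (j : Fin 3) (v : V7) (hv : v ∈ Hcode) : par j v = 0 := by
  have : Hcode ≤ LinearMap.ker (par j) := by
    refine Submodule.span_le.2 ?_
    have h : ∀ j k : Fin 3, (∑ i ∈ S j, r k i) = 0 := by decide
    rintro _ (rfl | rfl | rfl) <;> exact h j _
  exact this hv

lemma par_one (j : Fin 3) : par j 1 = 0 := by
  have h : ∀ j : Fin 3, (∑ i ∈ S j, (1 : V7) i) = 0 := by decide
  exact h j

lemma par_single (j : Fin 3) (i : Fin 7) :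
    par j (Pi.single i 1) = if i ∈ S j then 1 else 0 := by
  show (∑ k ∈ S j, (Pi.single i 1 : V7) k) = _
  simp [Pi.single_apply]

lemma e_mem (j : Fin 3) (w : V7) (hw : par j w = 0) : e w ∈ evenSub j := by
  intro v hv
  have : v ≠ w := by rintro rfl; exact hv hw
  simp [e, this]

lemma Cspace_le (j : Fin 3) : Cspace ≤ evenSub j := by
  refine Submodule.span_le.2 ?_
  rintro _ (rfl | rfl)
  · refine Submodule.smul_mem _ _ ?_
    exact finsum_mem_induction (· ∈ evenSub j) (zero_mem _) (fun _ _ => add_mem)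
      (fun w hw => e_mem j w (Hcode_par j w hw))
  · refine Submodule.smul_mem _ _ ?_
    exact finsum_mem_induction (· ∈ evenSub j) (zero_mem _) (fun _ _ => add_mem)
      (fun w hw => e_mem j _ (by rw [map_add, Hcode_par j w hw, par_one, add_zero]))

lemma key (ψ : H7) (hψ : ψ ∈ Cspace) (i : Fin 7) (j : Fin 3) :
    gZ j (Xop i ψ) = ((-1 : ℂ) ^ (if i ∈ S j then 1 else 0 : ZMod 2).val) • Xop i ψ := by
  funext v
  rw [gZ_apply, Pi.smul_apply, smul_eq_mul]
  show _ * ψ (v + Pi.single i 1) = _ * ψ (v + Pi.single i 1)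
  by_cases h : par j (v + Pi.single i 1) = 0
  · rw [map_add, par_single] at h
    rw [CharTwo.add_eq_zero.1 h]
  · rw [Cspace_le j hψ _ h, mul_zero, mul_zero]

/-- A single bit-flip error has deterministic syndrome given by support
membership: for `ψ` in the codespace, `gZ j (X i ψ) = ± X i ψ` according to
whether `i ∈ S j`. -/
theorem bitflip_syndrome (ψ : H7) (hψ : ψ ∈ Cspace) (i : Fin 7) (j : Fin 3) :
    (i ∉ S j → gZ j (Xop i ψ) = Xop i ψ) ∧
    (i ∈ S j → gZ j (Xop i ψ) = -(Xop i ψ)) := by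
  have h0 : (0 : ZMod 2).val = 0 := rfl
  have h1 : (1 : ZMod 2).val = 1 := rfl
  rw [key ψ hψ]
  constructor <;> intro h
  · rw [if_neg h, h0, pow_zero, one_smul]
  · rw [if_pos h, h1, pow_one, neg_one_smul]

end
end
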